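/- If 𝒟 is an SDDS dominating set, then 𝒟 \ {i ∈ V : i is Forbidden w.r.t. 𝒟} is an SDDS dominating set; that is, when all Forbidden vertices leave the dominating set simultaneously, domination is preserved. -/

import Mathlib

/-- A vertex `i` is Satisfied w.r.t. `D`. -/
def SddsSatisfied {V : Type*} {S : Type*} (G : SimpleGraph V)
    (Dem Srv : V → Set S) (D : Set V) (i : V) : Prop :=
  i ∈ D ∨ ∀ d ∈ Dem i, ∃ j, G.Adj i j ∧ d ∈ Srv j ∧ j ∈ D

/-- `D` is an SDDS dominating set. -/
def SddsDominating {V : Type*} {S : Type*} (G : SimpleGraph V)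
    (Dem Srv : V → Set S) (D : Set V) : Prop :=
  ∀ i, SddsSatisfied G Dem Srv D i

/-- A vertex `i` is Removable w.r.t. `D`. -/
def SddsRemovable {V : Type*} {S : Type*} (G : SimpleGraph V)
    (Dem Srv : V → Set S) (D : Set V) (i : V) : Prop :=
  (∀ d ∈ Dem i, ∃ j, G.Adj i j ∧ d ∈ Srv j ∧ j ∈ D) ∧
  (∀ j, G.Adj i j → ∀ d ∈ Dem j, d ∈ Srv i →
    ∃ k, G.Adj j k ∧ k ≠ i ∧ d ∈ Srv k ∧ k ∈ D)

/-- A vertex `i` is Forbidden w.r.t. `D`. -/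
def SddsForbidden {V : Type*} {S : Type*} (G : SimpleGraph V)
    (Dem Srv : V → Set S) (id : V → ℕ) (D : Set V) (i : V) : Prop :=
  i ∈ D ∧ SddsRemovable G Dem Srv D i ∧
  ∀ j, G.Adj i j → ∀ d ∈ Dem j, d ∈ Srv i →
    ∀ k, G.Adj j k → k ≠ i → d ∈ Srv k → k ∈ D →
      (id k < id i ∨ ¬ SddsRemovable G Dem Srv D k)

/-- removing all Forbidden vertices simultaneously preserves domination. -/
theorem sdds_remove_all_forbidden {V : Type*} [Fintype V] {S : Type*}
    (G : SimpleGraph V) (Dem Srv : V → Set S) (id : V → ℕ)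
    (hid : Function.Injective id) (D : Set V)
    (hD : SddsDominating G Dem Srv D) :
    SddsDominating G Dem Srv (D \ {i | SddsForbidden G Dem Srv id D i}) := by
  have key : ∀ i, (∀ d ∈ Dem i, ∃ j, G.Adj i j ∧ d ∈ Srv j ∧ j ∈ D) →
      ∀ d ∈ Dem i, ∃ j, G.Adj i j ∧ d ∈ Srv j ∧
        j ∈ D \ {i | SddsForbidden G Dem Srv id D i} := by
    intro i h d hd
    obtain ⟨j, hij, hdj, hjD⟩ := h d hd
    by_cases hj : SddsForbidden G Dem Srv id D j
    · obtain ⟨k, hik, hkj, hdk, hkD⟩ := hj.2.1.2 i hij.symm d hd hdj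
      refine ⟨k, hik, hdk, hkD, fun hk => ?_⟩
      have hk' : SddsForbidden G Dem Srv id D k := hk
      have h1 := (hj.2.2 i hij.symm d hd hdj k hik hkj hdk hkD).resolve_right
        (fun hn => hn hk'.2.1)
      have h2 := (hk'.2.2 i hik.symm d hd hdk j hij hkj.symm hdj hjD).resolve_right
        (fun hn => hn hj.2.1)
      omega
    · exact ⟨j, hij, hdj, hjD, hj⟩
  intro i
  by_cases hi : SddsForbidden G Dem Srv id D i
  · exact Or.inr (key i hi.2.1.1)
  · rcases hD i with h | h
    · exact Or.inl ⟨h, hi⟩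
    · exact Or.inr (key i h)
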